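/- arXiv:0806.4204 — 2 statements merged into one kernel-verified Lean document; each statement's English description precedes it below -/
import Mathlib

section
/- Let Ψ be an Orlicz function satisfying the Δ⁰ condition, (Ω,P) a probability space, X a closed linear subspace of the Morse–Transue space M^Ψ, and Y a Banach space. Let F be a family of bounded operators from X to Y with the following property: there exists a bounded sequence (g_n) in X such that ‖g_n‖_{L^1} → 0 and such that any T ∈ F with ‖T g_n‖ → 0 is compact. Then every weakly compact operator T ∈ F is compact. -/
open MeasureTheory Filter Set Topology ENNReal NNReal

noncomputable section

/-- An Orlicz function: non-decreasing, convex (indeed strictly convex), vanishing and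
continuous at `0`, with `Ψ x / x → ∞` as `x → ∞`. (We regard it as a function `ℝ → ℝ`,
only its values on `[0,∞)` being relevant.) -/
structure IsOrliczFunction (Ψ : ℝ → ℝ) : Prop where
  map_zero : Ψ 0 = 0
  nonneg : ∀ x, 0 ≤ Ψ x
  mono : MonotoneOn Ψ (Set.Ici (0 : ℝ))
  strictConvexOn : StrictConvexOn ℝ (Set.Ici (0 : ℝ)) Ψ
  continuousWithinAt_zero : ContinuousWithinAt Ψ (Set.Ici (0 : ℝ)) 0
  tendsto_div_atTop : Tendsto (fun x => Ψ x / x) atTop atTop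

/-- The Orlicz modular `∫ Ψ(|f|/C) dμ` (as an extended nonneg real). -/
def orliczModular {Ω : Type*} [MeasurableSpace Ω] (Ψ : ℝ → ℝ) (μ : Measure Ω)
    (f : Ω → ℂ) (C : ℝ) : ℝ≥0∞ :=
  ∫⁻ ω, ENNReal.ofReal (Ψ (‖f ω‖ / C)) ∂μ

/-- The Luxemburg norm. -/
def luxNorm {Ω : Type*} [MeasurableSpace Ω] (Ψ : ℝ → ℝ) (μ : Measure Ω) (f : Ω → ℂ) : ℝ :=
  sInf {C : ℝ | 0 < C ∧ orliczModular Ψ μ f C ≤ 1}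

/-- Membership in the Orlicz space `L^Ψ`. -/
def MemOrlicz {Ω : Type*} [MeasurableSpace Ω] (Ψ : ℝ → ℝ) (μ : Measure Ω) (f : Ω → ℂ) : Prop :=
  AEStronglyMeasurable f μ ∧ ∃ C > 0, orliczModular Ψ μ f C < ⊤

/-- Membership in the Morse–Transue space `M^Ψ` (the closure of `L^∞` in `L^Ψ`). -/
def MemMorseTransue {Ω : Type*} [MeasurableSpace Ω] (Ψ : ℝ → ℝ) (μ : Measure Ω)
    (f : Ω → ℂ) : Prop :=
  AEStronglyMeasurable f μ ∧ ∀ C > 0, orliczModular Ψ μ f C < ⊤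

/-- A subspace `X` is closed (in the Luxemburg norm) in the Morse–Transue space. -/
def IsLuxClosedIn {Ω : Type*} [MeasurableSpace Ω] (Ψ : ℝ → ℝ) (μ : Measure Ω)
    (X : Submodule ℂ (Ω → ℂ)) : Prop :=
  ∀ f : Ω → ℂ, MemMorseTransue Ψ μ f →
    (∀ ε > 0, ∃ g ∈ X, luxNorm Ψ μ (f - g) < ε) → f ∈ X

/-- A set in a normed space is relatively weakly compact. -/
def RelWeaklyCompact {Y : Type*} [NormedAddCommGroup Y] [NormedSpace ℂ Y] (S : Set Y) : Prop :=
  ∃ K : Set (WeakSpace ℂ Y), IsCompact K ∧ (toWeakSpace ℂ Y) '' S ⊆ K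

/-- The unit ball of a subspace `X` of `L^Ψ` for the Luxemburg norm. -/
def luxUnitBall {Ω : Type*} [MeasurableSpace Ω] (Ψ : ℝ → ℝ) (μ : Measure Ω)
    (X : Submodule ℂ (Ω → ℂ)) : Set X :=
  {f : X | luxNorm Ψ μ (f : Ω → ℂ) ≤ 1}

/-- An operator on a subspace of `L^Ψ` is weakly compact if the image of the unit ball is
relatively weakly compact. -/
def IsWeaklyCompactOp {Ω : Type*} [MeasurableSpace Ω] (Ψ : ℝ → ℝ) (μ : Measure Ω)
    {X : Submodule ℂ (Ω → ℂ)} {Y : Type*} [NormedAddCommGroup Y] [NormedSpace ℂ Y]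
    (T : X →ₗ[ℂ] Y) : Prop :=
  RelWeaklyCompact (⇑T '' luxUnitBall Ψ μ X)

/-- An operator on a subspace of `L^Ψ` is compact if the image of the unit ball is
relatively norm compact. -/
def IsCompactOp {Ω : Type*} [MeasurableSpace Ω] (Ψ : ℝ → ℝ) (μ : Measure Ω)
    {X : Submodule ℂ (Ω → ℂ)} {Y : Type*} [NormedAddCommGroup Y] [NormedSpace ℂ Y]
    (T : X →ₗ[ℂ] Y) : Prop :=
  IsCompact (closure (⇑T '' luxUnitBall Ψ μ X))

/-- `T` fixes a copy of `c₀`: there is a sequence in `X`, equivalent to the canonical basis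
of `c₀`, on whose (closed) span `T` is an isomorphism onto its image. -/
def FixesCopyOfC0 {Ω : Type*} [MeasurableSpace Ω] (Ψ : ℝ → ℝ) (μ : Measure Ω)
    {X : Submodule ℂ (Ω → ℂ)} {Y : Type*} [NormedAddCommGroup Y] [NormedSpace ℂ Y]
    (T : X →ₗ[ℂ] Y) : Prop :=
  ∃ (u : ℕ → X) (a b c : ℝ), 0 < a ∧ 0 < b ∧ 0 < c ∧
    ∀ (co : ℕ → ℂ) (s : Finset ℕ),
      a * (⨆ k ∈ s, ‖co k‖) ≤ luxNorm Ψ μ ((∑ k ∈ s, co k • u k : X) : Ω → ℂ) ∧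
      luxNorm Ψ μ ((∑ k ∈ s, co k • u k : X) : Ω → ℂ) ≤ b * (⨆ k ∈ s, ‖co k‖) ∧
      c * (⨆ k ∈ s, ‖co k‖) ≤ ‖T (∑ k ∈ s, co k • u k)‖

/-- The complementary (conjugate) Orlicz function `Φ(x) = sup_{y ≥ 0} (xy - Ψ(y))`. -/
def complementaryOrlicz (Ψ : ℝ → ℝ) (x : ℝ) : ℝ :=
  sSup ((fun y => x * y - Ψ y) '' Set.Ici (0 : ℝ))

/-- The `Δ₂` condition. -/
def Delta2 (Φ : ℝ → ℝ) : Prop :=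
  ∃ K > 0, ∃ x₀ > 0, ∀ x ≥ x₀, Φ (2 * x) ≤ K * Φ x

/-- The `Δ⁰` condition: for some `β > 1`, `Ψ(βx)/Ψ(x) → ∞` as `x → ∞`. -/
def Delta0 (Ψ : ℝ → ℝ) : Prop :=
  ∃ β > 1, Tendsto (fun x => Ψ (β * x) / Ψ x) atTop atTop

end

noncomputable section

theorem continuous_strongDual_toWeakSpace_symm {Y : Type*} [NormedAddCommGroup Y]
    [NormedSpace ℂ Y] (f : StrongDual ℂ Y) :
    Continuous fun x : WeakSpace ℂ Y => f ((toWeakSpace ℂ Y).symm x) :=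
  WeakBilin.eval_continuous (topDualPairing ℂ Y).flip f

/-- If all unimodular finite combinations of a sequence stay in a weakly compact set, the
sequence is weakly absolutely summable. -/
theorem summable_norm_dual_of_isCompact_weakSpace {Y : Type*} [NormedAddCommGroup Y]
    [NormedSpace ℂ Y] {K : Set (WeakSpace ℂ Y)} (hK : IsCompact K) {y : ℕ → Y}
    (hy : ∀ c : ℕ → ℂ, (∀ k, ‖c k‖ ≤ 1) → ∀ n,
      toWeakSpace ℂ Y (∑ k ∈ Finset.range n, c k • y k) ∈ K)
    (f : StrongDual ℂ Y) : Summable fun k => ‖f (y k)‖ := by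
  obtain ⟨B, hB⟩ := (hK.image (continuous_strongDual_toWeakSpace_symm f)).isBounded.exists_norm_le
  have hc : ∀ z : ℂ, ∃ c : ℂ, ‖c‖ ≤ 1 ∧ c * z = (‖z‖ : ℂ) := fun z => by
    obtain ⟨c, hc, h⟩ := RCLike.exists_norm_eq_mul_self z
    exact ⟨c, hc.le, h.symm⟩
  choose c hc1 hc2 using hc
  refine summable_of_sum_range_le (c := B) (fun _ => norm_nonneg _) fun n => ?_
  have h := hB _ (mem_image_of_mem _ (hy (fun k => c (f (y k))) (fun k => hc1 _) n))
  simp only [LinearEquiv.symm_apply_apply, map_sum, map_smul, smul_eq_mul, hc2] at h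
  rw [← Complex.ofReal_sum, Complex.norm_real] at h
  exact (le_abs_self _).trans h

/-- Orlicz–Pettis type theorem: a sequence all of whose finite combinations with coefficients in
the unit disc stay in a weakly compact set is not bounded away from zero. -/
theorem exists_norm_lt_of_isCompact_weakSpace {Y : Type*} [NormedAddCommGroup Y]
    [NormedSpace ℂ Y] {K : Set (WeakSpace ℂ Y)} (hK : IsCompact K) {y : ℕ → Y}
    (hy : ∀ c : ℕ → ℂ, (∀ k, ‖c k‖ ≤ 1) → ∀ n,
      toWeakSpace ℂ Y (∑ k ∈ Finset.range n, c k • y k) ∈ K)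
    {ε : ℝ} (hε : 0 < ε) : ∃ k, ‖y k‖ < ε := by
  have hsum := summable_norm_dual_of_isCompact_weakSpace hK hy
  let χ : (ℕ → Bool) → ℕ → ℂ := fun ω k => if ω k then 1 else 0
  have hχ : ∀ ω k, ‖χ ω k‖ ≤ 1 := fun ω k => by
    by_cases h : ω k = true <;> simp [χ, h]
  have hχy : ∀ (f : StrongDual ℂ Y) ω k, ‖χ ω k * f (y k)‖ ≤ ‖f (y k)‖ := fun f ω k => by
    rw [norm_mul]
    exact mul_le_of_le_one_left (norm_nonneg _) (hχ ω k)
  have hlim : ∀ ω, ∃ x : Y, x ∈ closure (Submodule.span ℂ (range y) : Set Y) ∧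
      ∀ f : StrongDual ℂ Y, HasSum (fun k => χ ω k * f (y k)) (f x) := fun ω => by
    obtain ⟨x, -, hx⟩ := hK.exists_mapClusterPt (f := atTop)
      (u := fun n => toWeakSpace ℂ Y (∑ k ∈ Finset.range n, χ ω k • y k))
      (le_principal_iff.2 <| mem_map.2 <| Eventually.of_forall (hy _ (hχ ω)))
    refine ⟨(toWeakSpace ℂ Y).symm x, ?_, fun f => ?_⟩
    · have hconv : Convex ℝ (Submodule.span ℂ (range y) : Set Y) :=
        ((Submodule.span ℂ (range y)).restrictScalars ℝ).convex
      have hmem : x ∈ closure (toWeakSpace ℂ Y '' (Submodule.span ℂ (range y) : Set Y)) := by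
        refine closure_mono ?_ (mapClusterPt_atTop_iff_forall_mem_closure.1 hx 0)
        rintro - ⟨n, -, rfl⟩
        exact mem_image_of_mem _ <| Submodule.sum_mem _ fun k _ =>
          Submodule.smul_mem _ _ (Submodule.subset_span (mem_range_self k))
      rw [← hconv.toWeakSpace_closure ℂ] at hmem
      obtain ⟨z, hz, rfl⟩ := hmem
      simpa using hz
    · have hs : Summable fun k => χ ω k * f (y k) := .of_norm_bounded (hsum f) (hχy f ω)
      have h1 := hx.continuousAt_comp (continuous_strongDual_toWeakSpace_symm f).continuousAt
      have h2 := hs.hasSum.tendsto_sum_nat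
      have h3 : (fun x : WeakSpace ℂ Y => f ((toWeakSpace ℂ Y).symm x)) ∘
          (fun n => toWeakSpace ℂ Y (∑ k ∈ Finset.range n, χ ω k • y k)) =
          fun n => ∑ k ∈ Finset.range n, χ ω k * f (y k) := by
        ext n
        simp
      rw [h3] at h1
      have h4 := eq_of_nhds_neBot (NeBot.mono h1 (inf_le_inf_left _ h2))
      rw [h4]
      exact hs.hasSum
  choose φ hφmem hφ using hlim
  obtain ⟨D, hDc, hD⟩ := ((countable_range y).isSeparable.span (R := ℂ)).closure
  have := hDc.to_subtype
  have hclosed : ∀ q : D, IsClosed {ω | ‖φ ω - q‖ ≤ ε / 3} := fun q => by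
    have : {ω | ‖φ ω - q‖ ≤ ε / 3} =
        ⋂ f : StrongDual ℂ Y, {ω | ‖∑' k, χ ω k * f (y k) - f q‖ ≤ ε / 3 * ‖f‖} := by
      ext ω
      simp only [mem_ofPred_eq, mem_iInter, (hφ ω _).tsum_eq, ← map_sub]
      refine ⟨fun h f => ?_, fun h => NormedSpace.norm_le_dual_bound ℂ _ (by positivity) h⟩
      rw [mul_comm]
      exact (f.le_opNorm _).trans (by gcongr)
    rw [this]
    refine isClosed_iInter fun f => isClosed_le (Continuous.norm (Continuous.sub ?_ ?_)) ?_
    · refine continuous_tsum (fun k => ?_) (hsum f) (fun k ω => hχy f ω k)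
      have : Continuous fun b : Bool => (if b then 1 else 0 : ℂ) := continuous_of_discreteTopology
      exact (this.comp (continuous_apply k)).mul continuous_const
    all_goals exact continuous_const
  have hcover : ⋃ q : D, {ω | ‖φ ω - q‖ ≤ ε / 3} = univ := by
    refine eq_univ_of_forall fun ω => ?_
    obtain ⟨q, hq, hqd⟩ := Metric.mem_closure_iff.1 (hD (hφmem ω)) (ε / 3) (by positivity)
    exact mem_iUnion.2 ⟨⟨q, hq⟩, by simpa [dist_eq_norm] using hqd.le⟩
  obtain ⟨q, ω, hω⟩ := nonempty_interior_of_iUnion_of_closed hclosed hcover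
  have hflip : Tendsto (fun k => Function.update ω k (!ω k)) atTop (𝓝 ω) := by
    refine tendsto_pi_nhds.2 fun i => tendsto_const_nhds.congr' ?_
    filter_upwards [eventually_gt_atTop i] with k hk
    simp [hk.ne]
  obtain ⟨k, hk⟩ := (hflip.eventually (isOpen_interior.mem_nhds hω)).exists
  have hball : ∀ ω ∈ interior {ω | ‖φ ω - q‖ ≤ ε / 3}, ‖φ ω - q‖ ≤ ε / 3 := fun ω h => by
    have := interior_subset h
    exact this
  have h3 : ‖y k‖ ≤ ‖φ (Function.update ω k (!ω k)) - φ ω‖ := by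
    refine NormedSpace.norm_le_dual_bound ℂ _ (norm_nonneg _) fun f => ?_
    have hupd : (fun i => χ (Function.update ω k (!ω k)) i * f (y i)) =
        Function.update (fun i => χ ω i * f (y i)) k (χ (fun i => !ω i) k * f (y k)) := by
      ext i
      by_cases hi : i = k
      · subst hi; simp [χ]
      · simp [χ, hi]
    have h4 := (hφ (Function.update ω k (!ω k)) f).unique
      (hupd ▸ (hφ ω f).update k (χ (fun i => !ω i) k * f (y k)))
    have h5 : ‖f (y k)‖ = ‖f (φ (Function.update ω k (!ω k)) - φ ω)‖ := by
      rw [map_sub, h4]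
      by_cases h : ω k = true <;> simp [χ, h]
    rw [h5, mul_comm]
    exact f.le_opNorm _
  refine ⟨k, ?_⟩
  calc ‖y k‖ ≤ ‖φ (Function.update ω k (!ω k)) - φ ω‖ := h3
    _ ≤ ‖φ (Function.update ω k (!ω k)) - q‖ + ‖φ ω - q‖ := by
      rw [norm_sub_rev (φ ω)]
      exact norm_sub_le_norm_sub_add_norm_sub _ _ _
    _ < ε := by linarith [hball _ hω, hball _ hk]

theorem IsOrliczFunction.continuousOn {Ψ : ℝ → ℝ} (hΨ : IsOrliczFunction Ψ) :
    ContinuousOn Ψ (Ici 0) :=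
  hΨ.strictConvexOn.convexOn.continuousOn_Ici hΨ.continuousWithinAt_zero

theorem IsOrliczFunction.map_mul_le {Ψ : ℝ → ℝ} (hΨ : IsOrliczFunction Ψ) {a x : ℝ}
    (ha : 0 ≤ a) (ha1 : a ≤ 1) (hx : 0 ≤ x) : Ψ (a * x) ≤ a * Ψ x := by
  have h := hΨ.strictConvexOn.convexOn.2 (mem_Ici.2 hx) (mem_Ici.2 le_rfl) ha
    (sub_nonneg.2 ha1) (by ring)
  simpa [hΨ.map_zero] using h

theorem IsOrliczFunction.map_add_div_two_le {Ψ : ℝ → ℝ} (hΨ : IsOrliczFunction Ψ) {x y : ℝ}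
    (hx : 0 ≤ x) (hy : 0 ≤ y) : Ψ ((x + y) / 2) ≤ Ψ x + Ψ y := by
  have h := hΨ.strictConvexOn.convexOn.2 (mem_Ici.2 hx) (mem_Ici.2 hy)
    (by norm_num : (0 : ℝ) ≤ 1 / 2) (by norm_num : (0 : ℝ) ≤ 1 / 2) (by norm_num)
  simp only [smul_eq_mul] at h
  rw [show (x + y) / 2 = 1 / 2 * x + 1 / 2 * y by ring]
  linarith [hΨ.nonneg x, hΨ.nonneg y]

theorem IsOrliczFunction.aemeasurable_comp {Ω : Type*} [MeasurableSpace Ω] {μ : Measure Ω}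
    {Ψ : ℝ → ℝ} (hΨ : IsOrliczFunction Ψ) {v : Ω → ℝ} (hv : AEMeasurable v μ)
    (hv0 : ∀ ω, 0 ≤ v ω) : AEMeasurable (fun ω => ENNReal.ofReal (Ψ (v ω))) μ := by
  have hmono : Monotone fun x : ℝ => Ψ (max x 0) := fun x y hxy =>
    hΨ.mono (mem_Ici.2 (le_max_right _ _)) (mem_Ici.2 (le_max_right _ _))
      (max_le_max_right 0 hxy)
  have h := (hmono.measurable.comp_aemeasurable hv).ennreal_ofReal
  simpa only [Function.comp_def, max_eq_left (hv0 _)] using h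

/-- Under `Δ⁰`, `Ψ` is dominated by a small multiple of a dilate of itself plus a linear term. -/
theorem IsOrliczFunction.exists_le_mul_add_of_tendsto {Ψ : ℝ → ℝ} (hΨ : IsOrliczFunction Ψ)
    {β : ℝ} (hβ : Tendsto (fun x => Ψ (β * x) / Ψ x) atTop atTop) {η : ℝ} (hη : 0 < η) :
    ∃ C, 0 ≤ C ∧ ∀ x, 0 ≤ x → Ψ x ≤ η * Ψ (β * x) + C * x := by
  obtain ⟨x₀, hx₀⟩ := eventually_atTop.1 (hβ.eventually_ge_atTop η⁻¹)
  set z := max x₀ 1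
  have hz : 0 < z := lt_max_of_lt_right one_pos
  refine ⟨Ψ z / z, div_nonneg (hΨ.nonneg _) hz.le, fun x hx => ?_⟩
  have hC : 0 ≤ Ψ z / z * x := mul_nonneg (div_nonneg (hΨ.nonneg _) hz.le) hx
  have hD : 0 ≤ η * Ψ (β * x) := mul_nonneg hη.le (hΨ.nonneg _)
  rcases le_total z x with h | h
  · have h1 := hx₀ x ((le_max_left _ _).trans h)
    rcases (hΨ.nonneg x).eq_or_lt with h0 | h0
    · rw [← h0]; positivity
    · rw [le_div_iff₀ h0, inv_mul_le_iff₀ hη] at h1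
      linarith
  · have h1 := hΨ.map_mul_le (div_nonneg hx hz.le) ((div_le_one hz).2 h) hz.le
    rw [div_mul_cancel₀ _ hz.ne'] at h1
    have : x / z * Ψ z = Ψ z / z * x := by ring
    linarith

theorem IsOrliczFunction.tendsto_lintegral_zero {Ω : Type*} [MeasurableSpace Ω] {μ : Measure Ω}
    {Ψ : ℝ → ℝ} (hΨ : IsOrliczFunction Ψ) {β : ℝ}
    (hβ : Tendsto (fun x => Ψ (β * x) / Ψ x) atTop atTop) {v : ℕ → Ω → ℝ}
    (hvm : ∀ n, AEMeasurable (v n) μ) (hv0 : ∀ n ω, 0 ≤ v n ω)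
    (hvβ : ∀ n, ∫⁻ ω, ENNReal.ofReal (Ψ (β * v n ω)) ∂μ ≤ 1)
    (hv1 : Tendsto (fun n => ∫⁻ ω, ENNReal.ofReal (v n ω) ∂μ) atTop (𝓝 0)) :
    Tendsto (fun n => ∫⁻ ω, ENNReal.ofReal (Ψ (v n ω)) ∂μ) atTop (𝓝 0) := by
  refine ENNReal.tendsto_nhds_zero.2 fun ε hε => ?_
  obtain ⟨η, hη0, hη⟩ := ENNReal.lt_iff_exists_nnreal_btwn.1 hε
  obtain ⟨C, hC, h⟩ := hΨ.exists_le_mul_add_of_tendsto hβ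
    (NNReal.coe_pos.2 (ENNReal.coe_pos.1 hη0))
  have hlim : Tendsto (fun n => (η : ℝ≥0∞) + ENNReal.ofReal C * ∫⁻ ω, ENNReal.ofReal (v n ω) ∂μ)
      atTop (𝓝 η) := by
    simpa using tendsto_const_nhds.add
      (ENNReal.Tendsto.const_mul hv1 (Or.inr (ENNReal.ofReal_ne_top (r := C))))
  filter_upwards [hlim.eventually (gt_mem_nhds hη)] with n hn
  refine le_trans ?_ hn.le
  calc ∫⁻ ω, ENNReal.ofReal (Ψ (v n ω)) ∂μ
      ≤ ∫⁻ ω, (η * ENNReal.ofReal (Ψ (β * v n ω)) +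
          ENNReal.ofReal C * ENNReal.ofReal (v n ω)) ∂μ := by
        refine lintegral_mono fun ω => ?_
        rw [← ENNReal.ofReal_coe_nnreal, ← ENNReal.ofReal_mul η.coe_nonneg, ← ENNReal.ofReal_mul hC,
          ← ENNReal.ofReal_add (mul_nonneg η.coe_nonneg (hΨ.nonneg _)) (mul_nonneg hC (hv0 n ω))]
        exact ENNReal.ofReal_le_ofReal (h _ (hv0 n ω))
    _ = η * ∫⁻ ω, ENNReal.ofReal (Ψ (β * v n ω)) ∂μ +
          ENNReal.ofReal C * ∫⁻ ω, ENNReal.ofReal (v n ω) ∂μ := by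
        rw [lintegral_add_right' _ ((hvm n).ennreal_ofReal.const_mul _),
          lintegral_const_mul' _ _ ENNReal.coe_ne_top,
          lintegral_const_mul' _ _ ENNReal.ofReal_ne_top]
    _ ≤ η + ENNReal.ofReal C * ∫⁻ ω, ENNReal.ofReal (v n ω) ∂μ := by
        gcongr
        exact mul_le_of_le_one_right' (hvβ n)

/-- A small perturbation changes the modular of `w / 2` only a little. -/
theorem IsOrliczFunction.tendsto_lintegral_add_div_two {Ω : Type*} [MeasurableSpace Ω]
    {μ : Measure Ω} {Ψ : ℝ → ℝ} (hΨ : IsOrliczFunction Ψ) {v : ℕ → Ω → ℝ}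
    (hvm : ∀ n, AEMeasurable (v n) μ) (hv0 : ∀ n ω, 0 ≤ v n ω)
    (hvΨ : ∑' n, ∫⁻ ω, ENNReal.ofReal (Ψ (v n ω)) ∂μ ≠ ⊤)
    (hv1 : ∑' n, ∫⁻ ω, ENNReal.ofReal (v n ω) ∂μ ≠ ⊤)
    {w : Ω → ℝ} (hwm : AEMeasurable w μ) (hw0 : ∀ ω, 0 ≤ w ω)
    (hw : ∫⁻ ω, ENNReal.ofReal (Ψ (w ω)) ∂μ ≠ ⊤) :
    Tendsto (fun n => ∫⁻ ω, ENNReal.ofReal (Ψ ((w ω + v n ω) / 2)) ∂μ) atTop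
      (𝓝 (∫⁻ ω, ENNReal.ofReal (Ψ (w ω / 2)) ∂μ)) := by
  refine tendsto_lintegral_of_dominated_convergence'
    (fun ω => ENNReal.ofReal (Ψ (w ω)) + ∑' n, ENNReal.ofReal (Ψ (v n ω)))
    (fun n => hΨ.aemeasurable_comp ((hwm.add (hvm n)).div_const 2)
      fun ω => div_nonneg (add_nonneg (hw0 ω) (hv0 n ω)) zero_le_two)
    (fun n => ae_of_all _ fun ω => ?_) ?_ ?_
  · calc ENNReal.ofReal (Ψ ((w ω + v n ω) / 2))
        ≤ ENNReal.ofReal (Ψ (w ω)) + ENNReal.ofReal (Ψ (v n ω)) := by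
          rw [← ENNReal.ofReal_add (hΨ.nonneg _) (hΨ.nonneg _)]
          exact ENNReal.ofReal_le_ofReal (hΨ.map_add_div_two_le (hw0 ω) (hv0 n ω))
      _ ≤ _ := add_le_add_right (ENNReal.le_tsum n) _
  · rw [lintegral_add_left' (hΨ.aemeasurable_comp hwm hw0),
      lintegral_tsum fun n => hΨ.aemeasurable_comp (hvm n) (hv0 n)]
    exact ENNReal.add_ne_top.2 ⟨hw, hvΨ⟩
  · rw [← lintegral_tsum fun n => (hvm n).ennreal_ofReal] at hv1
    filter_upwards [ae_lt_top' (.tsum fun n => (hvm n).ennreal_ofReal) hv1] with ω hω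
    have hv : Tendsto (fun n => v n ω) atTop (𝓝 0) := by
      have h := (ENNReal.tendsto_toReal ENNReal.zero_ne_top).comp
        (ENNReal.tendsto_atTop_zero_of_tsum_ne_top hω.ne)
      simpa [Function.comp_def, ENNReal.toReal_ofReal (hv0 _ ω)] using h
    have hlim : Tendsto (fun n => (w ω + v n ω) / 2) atTop (𝓝[Ici 0] (w ω / 2)) := by
      refine tendsto_nhdsWithin_iff.2 ⟨?_, Eventually.of_forall fun n =>
        div_nonneg (add_nonneg (hw0 ω) (hv0 n ω)) zero_le_two⟩
      simpa using (tendsto_const_nhds.add hv).div_const 2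
    exact ENNReal.tendsto_ofReal
      ((hΨ.continuousOn _ (mem_Ici.2 (div_nonneg (hw0 ω) zero_le_two))).tendsto.comp hlim)

/-- A sequence in the Morse–Transue class whose modulars and `L¹` norms are summable admits a
selection with uniformly bounded partial sums of moduli. -/
theorem IsOrliczFunction.exists_lintegral_sum_div_two_le {Ω : Type*} [MeasurableSpace Ω]
    {μ : Measure Ω} {Ψ : ℝ → ℝ} (hΨ : IsOrliczFunction Ψ) {v : ℕ → Ω → ℝ}
    (hvm : ∀ n, AEMeasurable (v n) μ) (hv0 : ∀ n ω, 0 ≤ v n ω)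
    (hv : ∀ n, ∀ C > 0, ∫⁻ ω, ENNReal.ofReal (Ψ (v n ω / C)) ∂μ < ⊤)
    (hvΨ : ∑' n, ∫⁻ ω, ENNReal.ofReal (Ψ (v n ω)) ∂μ ≠ ⊤)
    (hv1 : ∑' n, ∫⁻ ω, ENNReal.ofReal (v n ω) ∂μ ≠ ⊤) :
    ∃ ψ : ℕ → ℕ, ∀ K,
      ∫⁻ ω, ENNReal.ofReal (Ψ ((∑ k ∈ Finset.range K, v (ψ k) ω) / 2)) ∂μ ≤ 1 := by
  let P : (Ω → ℝ) → Prop := fun w => AEMeasurable w μ ∧ (∀ ω, 0 ≤ w ω) ∧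
    (∀ C > 0, ∫⁻ ω, ENNReal.ofReal (Ψ (w ω / C)) ∂μ < ⊤) ∧
    ∫⁻ ω, ENNReal.ofReal (Ψ (w ω / 2)) ∂μ < 1
  have hstep : ∀ w, ∃ n, P w → P (w + v n) := fun w => by
    by_cases hw : P w
    · obtain ⟨hwm, hw0, hwM, hw1⟩ := hw
      have hlim := hΨ.tendsto_lintegral_add_div_two hvm hv0 hvΨ hv1 hwm hw0
        (by simpa using (hwM 1 one_pos).ne)
      obtain ⟨n, hn⟩ := (hlim.eventually (gt_mem_nhds hw1)).exists
      refine ⟨n, fun _ => ⟨hwm.add (hvm n), fun ω => add_nonneg (hw0 ω) (hv0 n ω),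
        fun C hC => ?_, hn⟩⟩
      have hC2 : 0 < C / 2 := half_pos hC
      refine lt_of_le_of_lt (lintegral_mono fun ω => ?_)
        ((lintegral_add_left' (hΨ.aemeasurable_comp (hwm.div_const (C / 2))
          fun ω => div_nonneg (hw0 ω) hC2.le) fun ω => ENNReal.ofReal (Ψ (v n ω / (C / 2)))).trans_lt
          (ENNReal.add_lt_top.2 ⟨hwM _ hC2, hv n _ hC2⟩))
      rw [← ENNReal.ofReal_add (hΨ.nonneg _) (hΨ.nonneg _)]
      refine ENNReal.ofReal_le_ofReal ?_
      have h := hΨ.map_add_div_two_le (div_nonneg (hw0 ω) hC2.le) (div_nonneg (hv0 n ω) hC2.le)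
      convert h using 2
      simp only [Pi.add_apply]
      field_simp
    · exact ⟨0, fun h => absurd h hw⟩
  choose N hN using hstep
  let W : ℕ → Ω → ℝ := fun k => Nat.rec 0 (fun _ w => w + v (N w)) k
  have hP : ∀ k, P (W k) := fun k => by
    induction k with
    | zero =>
      refine ⟨aemeasurable_const, fun _ => le_rfl, fun C _ => ?_, ?_⟩ <;>
      simp [W, hΨ.map_zero]
    | succ k ih => exact hN _ ih
  have hW : ∀ K ω, W K ω = ∑ k ∈ Finset.range K, v (N (W k)) ω := fun K ω => by
    induction K with
    | zero => rfl
    | succ K ih => rw [Finset.sum_range_succ, ← ih]; rfl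
  refine ⟨fun k => N (W k), fun K => ?_⟩
  simp only [← hW]
  exact (hP K).2.2.2.le

theorem orliczModular_anti {Ω : Type*} [MeasurableSpace Ω] {μ : Measure Ω} {Ψ : ℝ → ℝ}
    (hΨ : IsOrliczFunction Ψ) (f : Ω → ℂ) {C D : ℝ} (hC : 0 < C) (hCD : C ≤ D) :
    orliczModular Ψ μ f D ≤ orliczModular Ψ μ f C :=
  lintegral_mono fun _ => ENNReal.ofReal_le_ofReal <|
    hΨ.mono (mem_Ici.2 (div_nonneg (norm_nonneg _) (hC.trans_le hCD).le))
      (mem_Ici.2 (div_nonneg (norm_nonneg _) hC.le))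
      (div_le_div_of_nonneg_left (norm_nonneg _) hC hCD)

theorem exists_orliczModular_le_one {Ω : Type*} [MeasurableSpace Ω] {μ : Measure Ω} {Ψ : ℝ → ℝ}
    (hΨ : IsOrliczFunction Ψ) {f : Ω → ℂ} (hf : orliczModular Ψ μ f 1 < ⊤) :
    ∃ C, 0 < C ∧ orliczModular Ψ μ f C ≤ 1 := by
  set m := (orliczModular Ψ μ f 1).toReal with hm
  have hm0 : 0 ≤ m := ENNReal.toReal_nonneg
  have hpos : 0 < m + 1 := by positivity
  refine ⟨m + 1, hpos, ?_⟩
  calc orliczModular Ψ μ f (m + 1)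
      ≤ ∫⁻ ω, ENNReal.ofReal (m + 1)⁻¹ * ENNReal.ofReal (Ψ (‖f ω‖ / 1)) ∂μ := by
        refine lintegral_mono fun ω => ?_
        rw [← ENNReal.ofReal_mul (inv_nonneg.2 hpos.le), div_eq_inv_mul, div_one]
        exact ENNReal.ofReal_le_ofReal (hΨ.map_mul_le (inv_nonneg.2 hpos.le)
          (inv_le_one_of_one_le₀ (by linarith)) (norm_nonneg _))
    _ = ENNReal.ofReal ((m + 1)⁻¹ * m) := by
        rw [lintegral_const_mul' _ _ ENNReal.ofReal_ne_top,
          ENNReal.ofReal_mul (inv_nonneg.2 hpos.le), hm, ENNReal.ofReal_toReal hf.ne]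
        rfl
    _ ≤ 1 := by
        rw [ENNReal.ofReal_le_one, inv_mul_le_iff₀ hpos]
        linarith

theorem orliczModular_le_one_of_luxNorm_lt {Ω : Type*} [MeasurableSpace Ω] {μ : Measure Ω}
    {Ψ : ℝ → ℝ} (hΨ : IsOrliczFunction Ψ) {f : Ω → ℂ} (hf : orliczModular Ψ μ f 1 < ⊤)
    {C : ℝ} (hC : luxNorm Ψ μ f < C) : orliczModular Ψ μ f C ≤ 1 := by
  obtain ⟨D, ⟨hD0, hD⟩, hDC⟩ := exists_lt_of_csInf_lt (exists_orliczModular_le_one hΨ hf) hC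
  exact (orliczModular_anti hΨ f hD0 hDC.le).trans hD

theorem luxNorm_le_of_orliczModular_le_one {Ω : Type*} [MeasurableSpace Ω] {μ : Measure Ω}
    {Ψ : ℝ → ℝ} {f : Ω → ℂ} {C : ℝ} (hC : 0 < C) (h : orliczModular Ψ μ f C ≤ 1) :
    luxNorm Ψ μ f ≤ C :=
  csInf_le ⟨0, fun _ hx => hx.1.le⟩ ⟨hC, h⟩

/-- Under `Δ⁰`, weakly compact operators send bounded sequences converging to zero in `L¹` to
norm null sequences. -/
theorem IsWeaklyCompactOp.tendsto_norm_zero {Ω : Type*} [MeasurableSpace Ω] {μ : Measure Ω}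
    {Ψ : ℝ → ℝ} (hΨ : IsOrliczFunction Ψ) (hΔ : Delta0 Ψ)
    {X : Submodule ℂ (Ω → ℂ)} (hXM : ∀ f ∈ X, MemMorseTransue Ψ μ f)
    {Y : Type*} [NormedAddCommGroup Y] [NormedSpace ℂ Y] {T : X →ₗ[ℂ] Y}
    (hT : IsWeaklyCompactOp Ψ μ T) {g : ℕ → X}
    (hgbdd : ∃ M : ℝ, ∀ n, luxNorm Ψ μ (g n : Ω → ℂ) ≤ M)
    (hgL1 : Tendsto (fun n => eLpNorm ((g n : Ω → ℂ)) 1 μ) atTop (𝓝 0)) :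
    Tendsto (fun n => ‖T (g n)‖) atTop (𝓝 0) := by
  obtain ⟨M, hM⟩ := hgbdd
  obtain ⟨β, hβ1, hβ⟩ := hΔ
  obtain ⟨K, hK, hTK⟩ := hT
  by_contra hcon
  obtain ⟨ε, hε, hfreq⟩ : ∃ ε > 0, ∃ᶠ n in atTop, ε ≤ ‖T (g n)‖ := by
    simpa [Metric.tendsto_nhds, Filter.Frequently] using hcon
  set C := max M 0 + 1
  have hC : 0 < C := by positivity
  have hMC : M < C := (le_max_left M 0).trans_lt (lt_add_one _)
  set R := β * C
  have hβ0 : 0 < β := one_pos.trans hβ1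
  have hR : 0 < R := mul_pos hβ0 hC
  let v : ℕ → Ω → ℝ := fun n ω => ‖(g n : Ω → ℂ) ω‖ / R
  have hv0 : ∀ n ω, 0 ≤ v n ω := fun n ω => div_nonneg (norm_nonneg _) hR.le
  have hvm : ∀ n, AEMeasurable (v n) μ := fun n =>
    (hXM _ (g n).2).1.norm.aemeasurable.div_const R
  have hvC : ∀ n, ∀ D > 0, ∫⁻ ω, ENNReal.ofReal (Ψ (v n ω / D)) ∂μ < ⊤ := fun n D hD => by
    simpa only [v, div_div, orliczModular] using (hXM _ (g n).2).2 (R * D) (mul_pos hR hD)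
  have hv1 : Tendsto (fun n => ∫⁻ ω, ENNReal.ofReal (v n ω) ∂μ) atTop (𝓝 0) := by
    have h : ∀ n, ∫⁻ ω, ENNReal.ofReal (v n ω) ∂μ =
        ENNReal.ofReal R⁻¹ * eLpNorm ((g n : Ω → ℂ)) 1 μ := fun n => by
      rw [eLpNorm_one_eq_lintegral_enorm, ← lintegral_const_mul' _ _ ENNReal.ofReal_ne_top]
      refine lintegral_congr fun ω => ?_
      rw [← ofReal_norm, ← ENNReal.ofReal_mul (inv_nonneg.2 hR.le), ← div_eq_inv_mul]
    simp only [h]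
    simpa using ENNReal.Tendsto.const_mul hgL1 (Or.inr (ENNReal.ofReal_ne_top (r := R⁻¹)))
  have hvΨ := hΨ.tendsto_lintegral_zero hβ hvm hv0 (fun n => by
    have h := orliczModular_le_one_of_luxNorm_lt hΨ ((hXM _ (g n).2).2 1 one_pos)
      ((hM n).trans_lt hMC)
    have hβv : ∀ ω, β * v n ω = ‖(g n : Ω → ℂ) ω‖ / C := fun ω => by
      simp only [v, R]
      field_simp
    simpa only [hβv, orliczModular] using h) hv1
  have hgeom : ∀ n : ℕ, (0 : ℝ≥0∞) < 2⁻¹ ^ n := fun n => by simp [ENNReal.pow_pos]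
  obtain ⟨φ, -, hφ⟩ := extraction_forall_of_frequently fun n =>
    hfreq.and_eventually ((ENNReal.tendsto_nhds_zero.1 hvΨ _ (hgeom n)).and
      (ENNReal.tendsto_nhds_zero.1 hv1 _ (hgeom n)))
  have hgeom_sum : ∑' n : ℕ, (2⁻¹ : ℝ≥0∞) ^ n ≠ ⊤ := by simp
  obtain ⟨ψ, hψ⟩ := hΨ.exists_lintegral_sum_div_two_le (v := fun n => v (φ n))
    (fun n => hvm _) (fun n => hv0 _) (fun n => hvC _)
    (ne_top_of_le_ne_top hgeom_sum (ENNReal.tsum_le_tsum fun n => (hφ n).2.1))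
    (ne_top_of_le_ne_top hgeom_sum (ENNReal.tsum_le_tsum fun n => (hφ n).2.2))
  have hr : 0 < (2 * R)⁻¹ := by positivity
  have hball : ∀ c : ℕ → ℂ, (∀ k, ‖c k‖ ≤ 1) → ∀ n, toWeakSpace ℂ Y
      (∑ k ∈ Finset.range n, c k • T (((2 * R)⁻¹ : ℂ) • g (φ (ψ k)))) ∈ K := fun c hc n => by
    simp only [← map_smul T, ← map_sum T]
    refine hTK (mem_image_of_mem _ (mem_image_of_mem _ ?_))
    refine luxNorm_le_of_orliczModular_le_one one_pos (le_trans (lintegral_mono fun ω => ?_) (hψ n))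
    refine ENNReal.ofReal_le_ofReal (hΨ.mono (mem_Ici.2 (by positivity))
      (mem_Ici.2 (div_nonneg (Finset.sum_nonneg fun k _ => hv0 _ ω) zero_le_two)) ?_)
    simp only [Submodule.coe_sum, Submodule.coe_smul, Finset.sum_apply, Pi.smul_apply, div_one,
      Finset.sum_div]
    refine norm_sum_le_of_le _ fun k _ => ?_
    rw [norm_smul, norm_smul]
    refine (mul_le_of_le_one_left (by positivity) (hc k)).trans_eq ?_
    simp only [v, norm_inv, norm_mul, Complex.norm_real, Complex.norm_ofNat,
      Real.norm_of_nonneg hR.le]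
    field_simp
  obtain ⟨k, hk⟩ := exists_norm_lt_of_isCompact_weakSpace hK hball (mul_pos hr hε)
  rw [map_smul, norm_smul, norm_inv, norm_mul, Complex.norm_real, Complex.norm_ofNat,
    Real.norm_of_nonneg hR.le] at hk
  exact (lt_of_mul_lt_mul_left hk hr.le).not_ge (hφ (ψ k)).1

/-- If `Ψ ∈ Δ⁰` and `F` is a family of bounded operators on a subspace `X` of `M^Ψ` such
that there is a bounded sequence `(g_n)` in `X` with `‖g_n‖₁ → 0` and every `T ∈ F` with
`‖T g_n‖ → 0` is compact, then every weakly compact `T ∈ F` is compact. -/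
theorem statement3 {Ω : Type*} [MeasurableSpace Ω] (μ : Measure Ω) [IsProbabilityMeasure μ]
    {Ψ : ℝ → ℝ} (hΨ : IsOrliczFunction Ψ) (hΔ : Delta0 Ψ)
    (X : Submodule ℂ (Ω → ℂ)) (hXM : ∀ f ∈ X, MemMorseTransue Ψ μ f)
    (hXclosed : IsLuxClosedIn Ψ μ X)
    {Y : Type*} [NormedAddCommGroup Y] [NormedSpace ℂ Y] [CompleteSpace Y]
    (F : Set (X →ₗ[ℂ] Y))
    (hFbdd : ∀ T ∈ F, ∃ M : ℝ, ∀ f : X, ‖T f‖ ≤ M * luxNorm Ψ μ (f : Ω → ℂ))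
    (g : ℕ → X) (hgbdd : ∃ M : ℝ, ∀ n, luxNorm Ψ μ (g n : Ω → ℂ) ≤ M)
    (hgL1 : Tendsto (fun n => eLpNorm ((g n : Ω → ℂ)) 1 μ) atTop (𝓝 0))
    (hFcomp : ∀ T ∈ F, Tendsto (fun n => ‖T (g n)‖) atTop (𝓝 0) → IsCompactOp Ψ μ T) :
    ∀ T ∈ F, IsWeaklyCompactOp Ψ μ T → IsCompactOp Ψ μ T := by
  intro T hTF hT
  exact hFcomp T hTF (hT.tendsto_norm_zero hΨ hΔ hXM hgbdd hgL1)

end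
end

section
/- Let Ψ be an Orlicz function, (Ω,P) a probability space, X a closed linear subspace of the Morse–Transue space M^Ψ, and (h_n) a sequence in X with ‖h_n‖_Ψ = 1 for all n ≥ 1 such that, for some M > 0, ∫_Ω Ψ(|h_n|/M) dP → 0 as n → ∞. Then (h_n) has a subsequence equivalent to the canonical basis of c₀, i.e., there are a subsequence (h_{n_k}) and constants 0 < a ≤ b such that for all finitely supported scalar sequences (c_k): a · max_k |c_k| ≤ ‖∑_k c_k h_{n_k}‖_Ψ ≤ b · max_k |c_k|. -/
open MeasureTheory Filter Set Topology ENNReal NNReal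

noncomputable section

/-- The modular `∫ Ψ(u) dμ` of a real-valued function. -/
def realModular {Ω : Type*} [MeasurableSpace Ω] (Ψ : ℝ → ℝ) (μ : Measure Ω)
    (u : Ω → ℝ) : ℝ≥0∞ :=
  ∫⁻ ω, ENNReal.ofReal (Ψ (u ω)) ∂μ

namespace IsOrliczFunction

variable {Ω : Type*} [MeasurableSpace Ω] {μ : Measure Ω} {Ψ : ℝ → ℝ}

lemma pos (hΨ : IsOrliczFunction Ψ) {x : ℝ} (hx : 0 < x) : 0 < Ψ x := by
  have h := hΨ.strictConvexOn.2 self_mem_Ici hx.le hx.ne one_half_pos one_half_pos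
    (add_halves 1)
  have h0 := hΨ.nonneg ((1 / 2 : ℝ) • (0 : ℝ) + (1 / 2 : ℝ) • x)
  simp only [hΨ.map_zero, smul_eq_mul] at h h0
  linarith

lemma map_half_le (hΨ : IsOrliczFunction Ψ) {x : ℝ} (hx : 0 ≤ x) : Ψ (x / 2) ≤ Ψ x / 2 := by
  have h := hΨ.strictConvexOn.convexOn.2 self_mem_Ici hx one_half_pos.le
    one_half_pos.le (add_halves 1)
  simp only [hΨ.map_zero, smul_eq_mul, mul_zero, zero_add] at h
  calc Ψ (x / 2) = Ψ (1 / 2 * x) := by ring_nf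
    _ ≤ Ψ x / 2 := by linarith

lemma aemeasurable_comp_s4 (hΨ : IsOrliczFunction Ψ) {u : Ω → ℝ} (hu : AEMeasurable u μ)
    (hu0 : ∀ ω, 0 ≤ u ω) : AEMeasurable (fun ω => Ψ (u ω)) μ := by
  have hmono : Monotone fun x : ℝ => Ψ (max x 0) := fun x y hxy =>
    hΨ.mono (le_max_right x 0) (le_max_right y 0) (max_le_max_right _ hxy)
  refine (hmono.measurable.comp_aemeasurable hu).congr (.of_forall fun ω => ?_)
  simp [hu0 ω]

lemma realModular_mono (hΨ : IsOrliczFunction Ψ) {u v : Ω → ℝ} (hu0 : ∀ ω, 0 ≤ u ω)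
    (huv : ∀ ω, u ω ≤ v ω) : realModular Ψ μ u ≤ realModular Ψ μ v :=
  lintegral_mono fun ω => ENNReal.ofReal_le_ofReal
    (hΨ.mono (hu0 ω) ((hu0 ω).trans (huv ω)) (huv ω))

/-- If `u` is pointwise dominated by the maximum of finitely many functions, its modular is at
most the sum of theirs. -/
lemma realModular_le_sum (hΨ : IsOrliczFunction Ψ) {ι : Type*} {s : Finset ι} {u : Ω → ℝ}
    {x : ι → Ω → ℝ} (hu0 : ∀ ω, 0 ≤ u ω) (hx : ∀ i ∈ s, AEMeasurable (x i) μ)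
    (hx0 : ∀ i ∈ s, ∀ ω, 0 ≤ x i ω) (hux : ∀ ω, ∃ i ∈ s, u ω ≤ x i ω) :
    realModular Ψ μ u ≤ ∑ i ∈ s, realModular Ψ μ (x i) := by
  unfold realModular
  rw [← lintegral_finsetSum' s
    fun i hi => (hΨ.aemeasurable_comp_s4 (hx i hi) (hx0 i hi)).ennreal_ofReal]
  refine lintegral_mono fun ω => ?_
  obtain ⟨i, hi, hle⟩ := hux ω
  exact (ENNReal.ofReal_le_ofReal (hΨ.mono (hu0 ω) (hx0 i hi ω) hle)).trans
    (Finset.single_le_sum (f := fun i => ENNReal.ofReal (Ψ (x i ω))) (fun _ _ => zero_le) hi)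

lemma realModular_le_add (hΨ : IsOrliczFunction Ψ) {u x y : Ω → ℝ} (hu0 : ∀ ω, 0 ≤ u ω)
    (hx : AEMeasurable x μ) (hx0 : ∀ ω, 0 ≤ x ω) (hy0 : ∀ ω, 0 ≤ y ω)
    (hu : ∀ ω, u ω ≤ x ω ∨ u ω ≤ y ω) :
    realModular Ψ μ u ≤ realModular Ψ μ x + realModular Ψ μ y := by
  unfold realModular
  rw [← lintegral_add_left' (hΨ.aemeasurable_comp_s4 hx hx0).ennreal_ofReal]
  refine lintegral_mono fun ω => ?_
  rcases hu ω with h | h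
  · exact (ENNReal.ofReal_le_ofReal (hΨ.mono (hu0 ω) (hx0 ω) h)).trans le_self_add
  · exact (ENNReal.ofReal_le_ofReal (hΨ.mono (hu0 ω) (hy0 ω) h)).trans le_add_self

lemma realModular_half_le_one (hΨ : IsOrliczFunction Ψ) {u : Ω → ℝ} (hu0 : ∀ ω, 0 ≤ u ω)
    (hu : realModular Ψ μ u ≤ 2) : realModular Ψ μ (fun ω => u ω / 2) ≤ 1 := by
  calc realModular Ψ μ (fun ω => u ω / 2)
      ≤ ∫⁻ ω, 2⁻¹ * ENNReal.ofReal (Ψ (u ω)) ∂μ := by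
        refine lintegral_mono fun ω => ?_
        refine (ENNReal.ofReal_le_ofReal (hΨ.map_half_le (hu0 ω))).trans_eq ?_
        rw [ENNReal.ofReal_div_of_pos two_pos, ENNReal.ofReal_ofNat, ENNReal.div_eq_inv_mul]
    _ = 2⁻¹ * realModular Ψ μ u := lintegral_const_mul' _ _ (by simp)
    _ ≤ 2⁻¹ * 2 := by gcongr
    _ = 1 := ENNReal.inv_mul_cancel two_ne_zero ofNat_ne_top

lemma tendsto_zero_of_comp (hΨ : IsOrliczFunction Ψ) {x : ℕ → ℝ} (hx : ∀ n, 0 ≤ x n)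
    (h : Tendsto (fun n => Ψ (x n)) atTop (𝓝 0)) : Tendsto x atTop (𝓝 0) := by
  refine tendsto_order.2 ⟨fun a ha => .of_forall fun n => ha.trans_le (hx n), fun a ha => ?_⟩
  filter_upwards [h.eventually_lt_const (hΨ.pos ha)] with n hn
  by_contra! hle
  exact (hΨ.mono ha.le (hx n) hle).not_gt hn

/-- Convergence to zero in modular yields a subsequence converging to zero almost everywhere. -/
lemma exists_subseq_tendsto_ae (hΨ : IsOrliczFunction Ψ) {u : ℕ → Ω → ℝ}
    (hu : ∀ n, AEMeasurable (u n) μ) (hu0 : ∀ n ω, 0 ≤ u n ω)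
    (h : Tendsto (fun n => realModular Ψ μ (u n)) atTop (𝓝 0)) :
    ∃ φ : ℕ → ℕ, StrictMono φ ∧ ∀ᵐ ω ∂μ, Tendsto (fun n => u (φ n) ω) atTop (𝓝 0) := by
  have hmeas : TendstoInMeasure μ (fun n ω => Ψ (u n ω)) atTop (fun _ => 0) := by
    refine tendstoInMeasure_of_tendsto_eLpNorm (p := 1) one_ne_zero
      (fun n => (hΨ.aemeasurable_comp_s4 (hu n) (hu0 n)).aestronglyMeasurable)
      aestronglyMeasurable_const ?_
    refine h.congr fun n => ?_
    simp only [eLpNorm_one_eq_lintegral_enorm, realModular]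
    refine lintegral_congr fun ω => ?_
    simp [Real.enorm_of_nonneg (hΨ.nonneg _)]
  obtain ⟨φ, hφ, hae⟩ := hmeas.exists_seq_tendsto_ae
  exact ⟨φ, hφ, hae.mono fun ω hω => hΨ.tendsto_zero_of_comp (fun n => hu0 _ ω) hω⟩

/-- Dominated convergence for modulars of truncations `C * min S (g m)`. -/
lemma tendsto_realModular_min (hΨ : IsOrliczFunction Ψ) {S : Ω → ℝ} {g : ℕ → Ω → ℝ} {C : ℝ}
    (hC : 0 ≤ C) (hS : AEMeasurable S μ) (hS0 : ∀ ω, 0 ≤ S ω) (hg : ∀ n, AEMeasurable (g n) μ)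
    (hg0 : ∀ n ω, 0 ≤ g n ω) (hfin : realModular Ψ μ (fun ω => C * S ω) ≠ ⊤)
    (hlim : ∀ᵐ ω ∂μ, Tendsto (fun n => g n ω) atTop (𝓝 0)) :
    Tendsto (fun n => realModular Ψ μ fun ω => C * min (S ω) (g n ω)) atTop (𝓝 0) := by
  have hmin0 : ∀ n ω, 0 ≤ C * min (S ω) (g n ω) := fun n ω =>
    mul_nonneg hC (le_min (hS0 ω) (hg0 n ω))
  have key := tendsto_lintegral_of_dominated_convergence' (μ := μ)
    (F := fun n ω => ENNReal.ofReal (Ψ (C * min (S ω) (g n ω)))) (f := fun _ => 0)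
    (fun ω => ENNReal.ofReal (Ψ (C * S ω)))
    (fun n => (hΨ.aemeasurable_comp_s4 ((hS.min (hg n)).const_mul C) (hmin0 n)).ennreal_ofReal)
    (fun n => .of_forall fun ω => ENNReal.ofReal_le_ofReal <|
      hΨ.mono (hmin0 n ω) (mul_nonneg hC (hS0 ω))
        (mul_le_mul_of_nonneg_left (min_le_left _ _) hC)) hfin ?_
  · simpa [realModular] using key
  filter_upwards [hlim] with ω hω
  have h1 : Tendsto (fun n => C * min (S ω) (g n ω)) atTop (𝓝 0) := by
    have := (tendsto_const_nhds (x := S ω)).min hω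
    simpa [hS0 ω] using this.const_mul C
  have h2 : Tendsto (fun n => C * min (S ω) (g n ω)) atTop (𝓝[Set.Ici 0] 0) :=
    tendsto_nhdsWithin_iff.2 ⟨h1, .of_forall fun n => hmin0 n ω⟩
  have h3 := hΨ.continuousWithinAt_zero.tendsto.comp h2
  rw [hΨ.map_zero] at h3
  simpa using ENNReal.tendsto_ofReal h3

lemma realModular_sum_ne_top (hΨ : IsOrliczFunction Ψ) {ι : Type*} (s : Finset ι)
    {x : ι → Ω → ℝ} (hx : ∀ i, AEMeasurable (x i) μ) (hx0 : ∀ i ω, 0 ≤ x i ω)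
    (hfin : ∀ i, ∀ C ≥ 0, realModular Ψ μ (fun ω => C * x i ω) ≠ ⊤) {C : ℝ} (hC : 0 ≤ C) :
    realModular Ψ μ (fun ω => C * ∑ i ∈ s, x i ω) ≠ ⊤ := by
  rcases s.eq_empty_or_nonempty with rfl | hs
  · simp [realModular, hΨ.map_zero]
  refine ne_top_of_le_ne_top ?_ (hΨ.realModular_le_sum (s := s)
    (x := fun i ω => (C * s.card) * x i ω)
    (fun ω => mul_nonneg hC (Finset.sum_nonneg fun i _ => hx0 i ω))
    (fun i _ => (hx i).const_mul _) (fun i _ ω => mul_nonneg (by positivity) (hx0 i ω))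
    fun ω => ?_)
  · exact ENNReal.sum_ne_top.2 fun i _ => hfin i _ (by positivity)
  · obtain ⟨i, hi, hmax⟩ := s.exists_max_image (fun i => x i ω) hs
    refine ⟨i, hi, ?_⟩
    rw [mul_assoc]
    refine mul_le_mul_of_nonneg_left ?_ hC
    simpa using Finset.sum_le_card_nsmul s (fun i => x i ω) _ hmax

end IsOrliczFunction

/-- A diagonal choice: each term may be required to satisfy any eventual condition depending on
the set of previous terms. -/
lemma exists_strictMono_of_forall_finset_eventually {P : Finset ℕ → ℕ → Prop}
    (hP : ∀ s, ∀ᶠ m in atTop, P s m) :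
    ∃ n : ℕ → ℕ, StrictMono n ∧ ∀ k, P ((Finset.range k).image n) (n k) := by
  have hex : ∀ s : Finset ℕ, ∃ m, P s m ∧ ∀ i ∈ s, i < m := fun s => by
    obtain ⟨m, hm, hlt⟩ := ((hP s).and (eventually_gt_atTop (s.sup id))).exists
    exact ⟨m, hm, fun i hi => (Finset.le_sup (f := id) hi).trans_lt hlt⟩
  choose N hN hlt using hex
  let T : ℕ → Finset ℕ := fun k => Nat.rec ∅ (fun _ s => insert (N s) s) k
  have hT : ∀ k, T k = (Finset.range k).image fun k => N (T k) := by
    intro k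
    induction k with
    | zero => rfl
    | succ k ih =>
      rw [Finset.range_add_one, Finset.image_insert, ← ih]
  refine ⟨fun k => N (T k), strictMono_nat_of_lt_succ fun k => ?_, fun k => ?_⟩
  · exact hlt _ _ (Finset.mem_insert_self _ _)
  · rw [← hT]
    exact hN _

lemma exists_sum_le_add_sum_min {g : ℕ → ℝ} (hg : ∀ i, 0 ≤ g i) (K : ℕ) :
    ∃ j ∈ Finset.range (K + 1), ∑ i ∈ Finset.range (K + 1), g i ≤
      g j + ∑ i ∈ Finset.range (K + 1), min (∑ l ∈ Finset.range i, g l) (g i) := by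
  induction K with
  | zero => exact ⟨0, by simp, by simp [hg 0]⟩
  | succ K ih =>
    obtain ⟨j, hj, hle⟩ := ih
    rw [Finset.sum_range_succ, Finset.sum_range_succ _ (K + 1)]
    rcases le_total (∑ i ∈ Finset.range (K + 1), g i) (g (K + 1)) with h | h
    · refine ⟨K + 1, by simp, ?_⟩
      rw [min_eq_left h]
      have : 0 ≤ ∑ i ∈ Finset.range (K + 1), min (∑ l ∈ Finset.range i, g l) (g i) :=
        Finset.sum_nonneg fun i _ => le_min (Finset.sum_nonneg fun _ _ => hg _) (hg i)
      linarith
    · refine ⟨j, by grind, ?_⟩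
      rw [min_eq_right h]
      linarith

lemma min_sum_sub_le_sum_min {g : ℕ → ℝ} (hg : ∀ i, 0 ≤ g i) {k K : ℕ} (hk : k < K) :
    min (∑ i ∈ Finset.range K, g i - g k) (g k) ≤
      ∑ i ∈ Finset.range K, min (∑ l ∈ Finset.range i, g l) (g i) := by
  induction K, hk using Nat.le_induction with
  | base =>
    rw [Finset.sum_range_succ, add_sub_cancel_right, Finset.sum_range_succ]
    exact le_add_of_nonneg_left (Finset.sum_nonneg fun i _ =>
      le_min (Finset.sum_nonneg fun _ _ => hg _) (hg i))
  | succ K hK ih =>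
    rw [Finset.sum_range_succ, Finset.sum_range_succ _ K]
    have h1 : g k ≤ ∑ i ∈ Finset.range K, g i :=
      Finset.single_le_sum (fun i _ => hg i) (Finset.mem_range.2 hK)
    have := hg K
    have := hg k
    grind

lemma sum_range_half_pow_le_one (K : ℕ) :
    ∑ k ∈ Finset.range K, (1 / 2 : ℝ) ^ (k + 1) ≤ 1 := by
  have : ∑ k ∈ Finset.range K, (1 / 2 : ℝ) ^ (k + 1) = 1 - (1 / 2) ^ K := by
    induction K with
    | zero => simp
    | succ K ih => rw [Finset.sum_range_succ, ih]; ring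
  rw [this]
  exact sub_le_self _ (by positivity)

lemma exists_sum_le_two_pow_mul {m : ℕ → ℝ} (hm : ∀ i, 0 ≤ m i) (K : ℕ) :
    ∃ j ∈ Finset.range (K + 1), ∑ i ∈ Finset.range (K + 1), m i ≤ 2 ^ (j + 1) * m j := by
  obtain ⟨j, hj, hmax⟩ := (Finset.range (K + 1)).exists_max_image (fun i => 2 ^ (i + 1) * m i)
    ⟨0, by simp⟩
  refine ⟨j, hj, ?_⟩
  calc ∑ i ∈ Finset.range (K + 1), m i
      = ∑ i ∈ Finset.range (K + 1), (1 / 2) ^ (i + 1) * (2 ^ (i + 1) * m i) := by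
        refine Finset.sum_congr rfl fun i _ => ?_
        rw [← mul_assoc, ← mul_pow]; norm_num
    _ ≤ ∑ i ∈ Finset.range (K + 1), (1 / 2) ^ (i + 1) * (2 ^ (j + 1) * m j) :=
        Finset.sum_le_sum fun i hi => mul_le_mul_of_nonneg_left (hmax i hi) (by positivity)
    _ ≤ 1 * (2 ^ (j + 1) * m j) := by
        rw [← Finset.sum_mul]
        exact mul_le_mul_of_nonneg_right (sum_range_half_pow_le_one _)
          (mul_nonneg (by positivity) (hm j))
    _ = _ := one_mul _

lemma sum_ofReal_half_pow_le_one (K : ℕ) :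
    ∑ k ∈ Finset.range K, ENNReal.ofReal ((1 / 2) ^ (k + 1)) ≤ 1 := by
  rw [← ENNReal.ofReal_sum_of_nonneg fun _ _ => by positivity]
  exact ENNReal.ofReal_le_one.2 (sum_range_half_pow_le_one K)

lemma biSup_finset_le {s : Finset ℕ} {x : ℕ → ℝ} {t : ℝ} (ht : 0 ≤ t) (h : ∀ k ∈ s, x k ≤ t) :
    ⨆ k ∈ s, x k ≤ t :=
  Real.iSup_le (fun k => Real.iSup_le (fun hk => h k hk) ht) ht

lemma le_biSup_finset {s : Finset ℕ} {x : ℕ → ℝ} (hx : ∀ k, 0 ≤ x k) {k : ℕ} (hk : k ∈ s) :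
    x k ≤ ⨆ k ∈ s, x k := by
  have hb : BddAbove (Set.range fun k => ⨆ (_ : k ∈ s), x k) := by
    refine ⟨∑ i ∈ s, x i, ?_⟩
    rintro _ ⟨i, rfl⟩
    exact Real.iSup_le (fun hi => Finset.single_le_sum (fun i _ => hx i) hi)
      (Finset.sum_nonneg fun i _ => hx i)
  refine le_ciSup_of_le hb k ?_
  simp [hk]

/-- A sequence of nonnegative functions tending to zero in modular has a subsequence whose
consecutive overlaps `min (∑ l < k, g l) (g k)` are summably small. -/
lemma IsOrliczFunction.exists_strictMono_small_overlap {Ω : Type*} [MeasurableSpace Ω]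
    {μ : Measure Ω} {Ψ : ℝ → ℝ} (hΨ : IsOrliczFunction Ψ) {f : ℕ → Ω → ℝ}
    (hf : ∀ n, AEMeasurable (f n) μ) (hf0 : ∀ n ω, 0 ≤ f n ω)
    (hfin : ∀ n, ∀ C ≥ 0, realModular Ψ μ (fun ω => C * f n ω) ≠ ⊤) {M : ℝ} (hM : 0 < M)
    (hmod : Tendsto (fun n => realModular Ψ μ fun ω => f n ω / M) atTop (𝓝 0)) :
    ∃ n : ℕ → ℕ, StrictMono n ∧ ∀ k,
      realModular Ψ μ (fun ω => f (n k) ω / M) ≤ ENNReal.ofReal ((1 / 2) ^ (k + 1)) ∧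
      realModular Ψ μ (fun ω => 2 ^ (k + 1) *
        (4 * min (∑ l ∈ Finset.range k, f (n l) ω) (f (n k) ω))) ≤
          ENNReal.ofReal ((1 / 2) ^ (k + 1)) := by
  obtain ⟨φ, hφ, hae⟩ := hΨ.exists_subseq_tendsto_ae (fun n => (hf n).div_const M)
    (fun n ω => div_nonneg (hf0 n ω) hM.le) hmod
  have hae' : ∀ᵐ ω ∂μ, Tendsto (fun n => f (φ n) ω) atTop (𝓝 0) := by
    filter_upwards [hae] with ω hω
    simpa [div_mul_cancel₀ _ hM.ne'] using hω.mul_const M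
  have hpos : ∀ k : ℕ, 0 < ENNReal.ofReal ((1 / 2) ^ (k + 1)) := fun k =>
    ENNReal.ofReal_pos.2 (by positivity)
  obtain ⟨n, hn, hP⟩ := exists_strictMono_of_forall_finset_eventually
    (P := fun s m =>
      realModular Ψ μ (fun ω => f (φ m) ω / M) ≤ ENNReal.ofReal ((1 / 2) ^ (s.card + 1)) ∧
      realModular Ψ μ (fun ω => (2 ^ (s.card + 1) * 4) *
        min (∑ l ∈ s, f (φ l) ω) (f (φ m) ω)) ≤ ENNReal.ofReal ((1 / 2) ^ (s.card + 1)))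
    fun s => ((hmod.comp hφ.tendsto_atTop).eventually_le_const (hpos _)).and <|
      (hΨ.tendsto_realModular_min (by positivity)
        (Finset.aemeasurable_fun_sum s fun l _ => hf (φ l))
        (fun ω => Finset.sum_nonneg fun l _ => hf0 _ ω) (fun m => hf (φ m))
        (fun m => hf0 (φ m)) (hΨ.realModular_sum_ne_top s (fun l => hf (φ l))
          (fun l => hf0 (φ l)) (fun l => hfin (φ l)) (by positivity)) hae').eventually_le_const
        (hpos _)
  refine ⟨φ ∘ n, hφ.comp hn, fun k => ?_⟩
  have h := hP k
  simp only [Finset.card_image_of_injective _ hn.injective, Finset.card_range,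
    Finset.sum_image hn.injective.injOn] at h
  simpa only [Function.comp_apply, mul_assoc] using h

end

noncomputable section

/-- If `(h_n)` is a sequence in a subspace `X` of `M^Ψ` with `‖h_n‖_Ψ = 1` and
`∫ Ψ(|h_n|/M) dP → 0` for some `M > 0`, then `(h_n)` has a subsequence equivalent to the
canonical basis of `c₀`. -/
theorem statement4 {Ω : Type*} [MeasurableSpace Ω] (μ : Measure Ω) [IsProbabilityMeasure μ]
    {Ψ : ℝ → ℝ} (hΨ : IsOrliczFunction Ψ)
    (X : Submodule ℂ (Ω → ℂ)) (hXM : ∀ f ∈ X, MemMorseTransue Ψ μ f)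
    (hXclosed : IsLuxClosedIn Ψ μ X)
    (h : ℕ → X) (hnorm : ∀ n, luxNorm Ψ μ (h n : Ω → ℂ) = 1)
    (M : ℝ) (hM : 0 < M)
    (hmod : Tendsto (fun n => orliczModular Ψ μ (h n : Ω → ℂ) M) atTop (𝓝 0)) :
    ∃ n : ℕ → ℕ, StrictMono n ∧ ∃ a b : ℝ, 0 < a ∧ a ≤ b ∧
      ∀ (c : ℕ → ℂ) (s : Finset ℕ),
        a * (⨆ k ∈ s, ‖c k‖)
            ≤ luxNorm Ψ μ ((∑ k ∈ s, c k • h (n k) : X) : Ω → ℂ) ∧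
        luxNorm Ψ μ ((∑ k ∈ s, c k • h (n k) : X) : Ω → ℂ)
            ≤ b * (⨆ k ∈ s, ‖c k‖) := by

  have hmeas : ∀ n, AEMeasurable (fun ω => ‖(h n : Ω → ℂ) ω‖) μ := fun n =>
    (hXM _ (h n).2).1.norm.aemeasurable
  have hfin : ∀ n, ∀ C ≥ 0, realModular Ψ μ (fun ω => C * ‖(h n : Ω → ℂ) ω‖) ≠ ⊤ := by
    intro n C hC
    rcases hC.eq_or_lt with rfl | hC
    · simp [realModular, hΨ.map_zero]
    · have := ((hXM _ (h n).2).2 C⁻¹ (inv_pos.2 hC)).ne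
      simpa [orliczModular, realModular, div_inv_eq_mul, mul_comm] using this
  obtain ⟨n, hn, hsmall⟩ := hΨ.exists_strictMono_small_overlap hmeas
    (fun n ω => norm_nonneg _) hfin hM hmod
  refine ⟨n, hn, 1 / 4, 2 * (M + 1 / 4), by norm_num, by linarith, fun c s => ?_⟩
  set g : ℕ → Ω → ℝ := fun k ω => ‖(h (n k) : Ω → ℂ) ω‖ with hg
  have hg0 : ∀ k ω, 0 ≤ g k ω := fun k ω => norm_nonneg _
  have hgm : ∀ k, AEMeasurable (g k) μ := fun k => hmeas (n k)
  set m : ℕ → Ω → ℝ := fun k ω => min (∑ l ∈ Finset.range k, g l ω) (g k ω) with hm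
  have hm0 : ∀ k ω, 0 ≤ m k ω := fun k ω =>
    le_min (Finset.sum_nonneg fun l _ => hg0 l ω) (hg0 k ω)
  have hmm : ∀ k, AEMeasurable (m k) μ := fun k =>
    (Finset.aemeasurable_fun_sum _ fun l _ => hgm l).min (hgm k)
  set t : ℝ := ⨆ k ∈ s, ‖c k‖ with ht
  have ht0 : 0 ≤ t := Real.iSup_nonneg fun k => Real.iSup_nonneg fun _ => norm_nonneg _
  have hct : ∀ k ∈ s, ‖c k‖ ≤ t := fun k hk => le_biSup_finset (fun k => norm_nonneg (c k)) hk
  set F : Ω → ℂ := ((∑ k ∈ s, c k • h (n k) : X) : Ω → ℂ) with hF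
  have hFeq : ∀ ω, F ω = ∑ k ∈ s, c k * (h (n k) : Ω → ℂ) ω := fun ω => by
    simp [hF, Finset.sum_apply]
  obtain ⟨K, hK⟩ : ∃ K, s ⊆ Finset.range (K + 1) :=
    ⟨s.sup id, fun i hi => Finset.mem_range_succ_iff.2 (Finset.le_sup (f := id) hi)⟩
  set R : Ω → ℝ := fun ω => ∑ k ∈ Finset.range (K + 1), m k ω with hR
  have hR0 : ∀ ω, 0 ≤ R ω := fun ω => Finset.sum_nonneg fun k _ => hm0 k ω
  have hRm : AEMeasurable R μ := Finset.aemeasurable_fun_sum _ fun k _ => hmm k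
  have hRmod : realModular Ψ μ (fun ω => 4 * R ω) ≤ 1 := by
    refine (hΨ.realModular_le_sum (s := Finset.range (K + 1))
      (x := fun k ω => 2 ^ (k + 1) * (4 * m k ω)) (fun ω => mul_nonneg (by norm_num) (hR0 ω))
      (fun k _ => ((hmm k).const_mul _).const_mul _)
      (fun k _ ω => by have := hm0 k ω; positivity) fun ω => ?_).trans
      ((Finset.sum_le_sum fun k _ => (hsmall k).2).trans (sum_ofReal_half_pow_le_one _))
    obtain ⟨j, hj, hle⟩ := exists_sum_le_two_pow_mul (m := fun k => 4 * m k ω)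
      (fun k => by have := hm0 k ω; positivity) K
    exact ⟨j, hj, by rwa [hR, Finset.mul_sum]⟩
  have hupper : ∀ t' > 0, t ≤ t' → orliczModular Ψ μ F (2 * (M + 1 / 4) * t') ≤ 1 := by
    intro t' ht' htt'
    have hu0 : ∀ ω, 0 ≤ ‖F ω‖ / (t' * (M + 1 / 4)) := fun ω => by positivity
    set G : Ω → ℝ := fun ω => (Finset.range (K + 1)).sup' ⟨0, by simp⟩ (fun k => g k ω / M)
    have hGle : ∀ ω, ∃ j ∈ Finset.range (K + 1), G ω = g j ω / M := fun ω =>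
      Finset.exists_mem_eq_sup' _ _
    have hG0 : ∀ ω, 0 ≤ G ω := fun ω => by
      obtain ⟨j, -, hj⟩ := hGle ω
      rw [hj]
      exact div_nonneg (hg0 j ω) hM.le
    have hGmod : realModular Ψ μ G ≤ 1 :=
      (hΨ.realModular_le_sum (s := Finset.range (K + 1)) (x := fun k ω => g k ω / M) hG0
        (fun k _ => (hgm k).div_const M) (fun k _ ω => div_nonneg (hg0 k ω) hM.le)
        fun ω => (hGle ω).imp fun j hj => ⟨hj.1, hj.2.le⟩).trans
        ((Finset.sum_le_sum fun k _ => (hsmall k).1).trans (sum_ofReal_half_pow_le_one _))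
    have hpt : ∀ ω, ‖F ω‖ / (t' * (M + 1 / 4)) ≤ 4 * R ω ∨ ‖F ω‖ / (t' * (M + 1 / 4)) ≤ G ω := by
      intro ω
      have h1 : ‖F ω‖ ≤ t' * ∑ k ∈ Finset.range (K + 1), g k ω := by
        rw [hFeq]
        calc ‖∑ k ∈ s, c k * (h (n k) : Ω → ℂ) ω‖ ≤ ∑ k ∈ s, t' * g k ω :=
              norm_sum_le_of_le _ fun k hk => by
                rw [norm_mul]
                exact mul_le_mul_of_nonneg_right ((hct k hk).trans htt') (norm_nonneg _)
          _ ≤ ∑ k ∈ Finset.range (K + 1), t' * g k ω :=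
              Finset.sum_le_sum_of_subset_of_nonneg hK fun k _ _ => mul_nonneg ht'.le (hg0 k ω)
          _ = _ := (Finset.mul_sum _ _ _).symm
      obtain ⟨j, hj, hle⟩ := exists_sum_le_add_sum_min (fun k => hg0 k ω) K
      have h2 : g j ω ≤ M * G ω := by
        rw [← div_le_iff₀' hM]
        exact Finset.le_sup' (fun k => g k ω / M) hj
      have h3 : ‖F ω‖ ≤ t' * (M * G ω + R ω) :=
        h1.trans (mul_le_mul_of_nonneg_left (hle.trans (add_le_add_left h2 _)) ht'.le)
      by_contra! hcon
      obtain ⟨h4, h5⟩ := hcon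
      have h6 : ‖F ω‖ / (t' * (M + 1 / 4)) * (M + 1 / 4) ≤ M * G ω + R ω := by
        rw [← div_div, div_mul_cancel₀ _ (by positivity), div_le_iff₀' ht']
        exact h3
      nlinarith
    have := hΨ.realModular_half_le_one hu0 <|
      (hΨ.realModular_le_add hu0 (hRm.const_mul 4) (fun ω => by have := hR0 ω; positivity)
        hG0 hpt).trans ((add_le_add hRmod hGmod).trans_eq one_add_one_eq_two)
    refine le_of_eq_of_le ?_ this
    simp only [orliczModular, realModular, div_div]
    rw [show 2 * (M + 1 / 4) * t' = t' * (M + 1 / 4) * 2 by ring]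
  have hbdd : BddBelow {C : ℝ | 0 < C ∧ orliczModular Ψ μ F C ≤ 1} := ⟨0, fun C hC => hC.1.le⟩
  constructor
  · rcases ht0.eq_or_lt with ht0 | htpos
    · rw [← ht0, mul_zero]
      exact Real.sInf_nonneg fun C hC => hC.1.le
    refine le_csInf ⟨_, by positivity, hupper t htpos le_rfl⟩ ?_
    rintro C ⟨hC, hCmod⟩
    obtain ⟨k, hk, hkt⟩ : ∃ k ∈ s, ‖c k‖ = t := by
      by_contra! hne
      have hs : s.Nonempty := by
        rw [Finset.nonempty_iff_ne_empty]
        rintro rfl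
        simp [ht] at htpos
      obtain ⟨k, hk, hmax⟩ := s.exists_max_image (fun k => ‖c k‖) hs
      exact hne k hk ((hct k hk).antisymm (biSup_finset_le (norm_nonneg _) hmax))
    have hpt : ∀ ω, t * g k ω ≤ ‖F ω‖ + t * R ω := by
      intro ω
      have h1 : t * g k ω ≤ ‖F ω‖ + t * (∑ i ∈ Finset.range (K + 1), g i ω - g k ω) := by
        have h2 : c k * (h (n k) : Ω → ℂ) ω
            = F ω - ∑ i ∈ s.erase k, c i * (h (n i) : Ω → ℂ) ω := by
          rw [hFeq, ← Finset.add_sum_erase s _ hk, add_sub_cancel_right]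
        calc t * g k ω = ‖c k * (h (n k) : Ω → ℂ) ω‖ := by rw [norm_mul, hkt]
          _ ≤ ‖F ω‖ + ‖∑ i ∈ s.erase k, c i * (h (n i) : Ω → ℂ) ω‖ := by
              rw [h2]; exact norm_sub_le _ _
          _ ≤ ‖F ω‖ + ∑ i ∈ s.erase k, t * g i ω := by
              gcongr
              refine norm_sum_le_of_le _ fun i hi => ?_
              rw [norm_mul]
              exact mul_le_mul_of_nonneg_right (hct i (Finset.mem_of_mem_erase hi))
                (norm_nonneg _)
          _ ≤ ‖F ω‖ + ∑ i ∈ (Finset.range (K + 1)).erase k, t * g i ω := by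
              gcongr
          _ = _ := by
              rw [← Finset.mul_sum, ← Finset.add_sum_erase _ (fun i => g i ω) (hK hk),
                add_sub_cancel_left]
      have h3 := min_sum_sub_le_sum_min (fun i => hg0 i ω) (Finset.mem_range.1 (hK hk))
      rcases min_le_iff.1 h3 with h4 | h4
      · exact h1.trans (add_le_add_right (mul_le_mul_of_nonneg_left h4 ht0) _)
      · exact (mul_le_mul_of_nonneg_left h4 ht0).trans (le_add_of_nonneg_left (norm_nonneg _))
    set D : ℝ := C / t + 1 / 4 with hD
    have hDpos : 0 < D := by positivity
    have hu0 : ∀ ω, 0 ≤ g k ω / D := fun ω => div_nonneg (hg0 k ω) hDpos.le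
    have hdom : ∀ ω, g k ω / D ≤ 4 * R ω ∨ g k ω / D ≤ ‖F ω‖ / C := by
      intro ω
      by_contra! hcon
      obtain ⟨h4, h5⟩ := hcon
      have h6 : g k ω / D * (C + t / 4) = t * g k ω := by
        have : C + t / 4 = t * D := by rw [hD]; field_simp
        rw [this]; field_simp
      have h7 : ‖F ω‖ < g k ω / D * C := (div_lt_iff₀ hC).1 h5
      nlinarith [hpt ω]
    have h1 := hΨ.realModular_half_le_one hu0 <|
      (hΨ.realModular_le_add hu0 (hRm.const_mul 4) (fun ω => by have := hR0 ω; positivity)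
        (fun ω => by positivity) hdom).trans
        ((add_le_add hRmod hCmod).trans_eq one_add_one_eq_two)
    have h2 : luxNorm Ψ μ (h (n k) : Ω → ℂ) ≤ D * 2 := by
      refine csInf_le ⟨0, fun C hC => hC.1.le⟩ ⟨by positivity, ?_⟩
      simpa only [orliczModular, realModular, div_div] using h1
    rw [hnorm] at h2
    have h3 : 1 / 4 ≤ C / t := by linarith
    exact (le_div_iff₀ htpos).1 h3
  · refine le_of_forall_pos_le_add fun ε hε => ?_
    have hb : 0 < 2 * (M + 1 / 4) := by positivity
    have hδ : 0 < ε / (2 * (M + 1 / 4)) := by positivity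
    refine (csInf_le hbdd ⟨?_, hupper (t + ε / (2 * (M + 1 / 4))) (by linarith)
      (by linarith)⟩).trans_eq ?_
    · positivity
    · rw [mul_add, mul_div_cancel₀ _ hb.ne']

end
end
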